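/- arXiv:1705.07851 — 7 statements merged into one kernel-verified Lean document; each statement's English description precedes it below -/
import Mathlib

section
/- For every integer i ≥ 1 and every nonnegative integer j, the adjusted moments satisfy the four-term recursion μ̃_{i+1,j+1} = [i + j − 1 + 2α + √(α+1)] · μ̃_{i+1,j} + [(1 − i − j)(α+1) + (3 − 3i − j − 4α)√(α+1)] · μ̃_{i,j} + [(2i − 4)(α+1)(√(α+1) + 1)] · μ̃_{i−1,j}. -/
open MeasureTheory

open Filter Topology Asymptotics in
theorem aux_bigO (α r s : ℝ) (hα : 0 < α) (hr : r < 0) (hs : s < 0) (i j : ℕ) :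
    (fun x : ℝ => (x - r) ^ i * (x - s) ^ j *
      (x ^ α * Real.exp (-x) * (4 / ((x - r) ^ 2 * (x - s) ^ 2)))) =O[atTop]
      (fun x : ℝ => Real.exp (-(1/4) * x)) := by
  have h2 : ∀ (c : ℝ) (n : ℕ), (fun x : ℝ => (x - c) ^ n) =O[atTop]
      (fun x : ℝ => Real.exp (1/4 * x)) := by
    intro c n
    have b1 : (fun x : ℝ => x - c) =O[atTop] (fun x : ℝ => x) := by
      refine (isBigO_refl _ _).sub ?_
      exact (isLittleO_const_id_atTop c).isBigO
    have := (b1.pow n).trans (isLittleO_pow_exp_pos_mul_atTop (b := 1/4) n (by norm_num)).isBigO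
    exact this
  have h3 : (fun x : ℝ => x ^ α) =O[atTop] (fun x : ℝ => Real.exp (1/4 * x)) :=
    (isLittleO_rpow_exp_pos_mul_atTop α (by norm_num)).isBigO
  have h4 : (fun x : ℝ => 4 / ((x - r) ^ 2 * (x - s) ^ 2)) =O[atTop] (fun _ : ℝ => (1:ℝ)) := by
    refine IsBigO.of_bound (4 / (r ^ 2 * s ^ 2)) ?_
    filter_upwards [eventually_ge_atTop 0] with x hx
    have p1 : r ^ 2 ≤ (x - r) ^ 2 := by nlinarith
    have p2 : s ^ 2 ≤ (x - s) ^ 2 := by nlinarith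
    have p3 : 0 < r ^ 2 := by nlinarith
    have p4 : 0 < s ^ 2 := by nlinarith
    rw [Real.norm_of_nonneg (by positivity)]
    simp only [norm_one, mul_one]
    gcongr
  have h5 := ((h2 r i).mul (h2 s j)).mul ((h3.mul (isBigO_refl (fun x : ℝ => Real.exp (-x)) atTop)).mul h4)
  refine h5.congr_right ?_
  intro x
  rw [mul_one, ← Real.exp_add, ← Real.exp_add, ← Real.exp_add]
  congr 1; ring

theorem aux_cont (α r s : ℝ) (hα : 0 < α) (hr : r < 0) (hs : s < 0) (i j : ℕ) :
    ContinuousOn (fun x : ℝ => (x - r) ^ i * (x - s) ^ j *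
      (x ^ α * Real.exp (-x) * (4 / ((x - r) ^ 2 * (x - s) ^ 2)))) (Set.Ici 0) := by
  have h0 : ContinuousOn (fun x : ℝ => x ^ α) (Set.Ici 0) :=
    (Real.continuous_rpow_const hα.le).continuousOn
  have h1 : ContinuousOn (fun x : ℝ => 4 / ((x - r) ^ 2 * (x - s) ^ 2)) (Set.Ici 0) := by
    refine ContinuousOn.div (by fun_prop) (by fun_prop) ?_
    intro x hx
    have hx' : 0 ≤ x := hx
    have : 0 < x - r := by linarith
    have : 0 < x - s := by linarith
    positivity
  exact ContinuousOn.mul (by fun_prop) ((h0.mul (by fun_prop)).mul h1)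

theorem aux_deriv (α r s : ℝ) (hr : r < 0) (hs : s < 0) (k j : ℕ) (x : ℝ) (hx : 0 < x) :
    HasDerivAt (fun x : ℝ => x * ((x - r) ^ (k + 1) * (x - s) ^ (j + 1) *
      (x ^ α * Real.exp (-x) * (4 / ((x - r) ^ 2 * (x - s) ^ 2)))))
      (((x - r) ^ k * (x - s) ^ j * (x ^ α * Real.exp (-x) * (4 / ((x - r) ^ 2 * (x - s) ^ 2)))) *
        ((α + 1 - x) * (x - r) * (x - s) + ((k : ℝ) - 1) * x * (x - s)
          + ((j : ℝ) - 1) * x * (x - r))) x := by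
  have hp : 0 < x - r := by linarith
  have hq : 0 < x - s := by linarith
  have d1 : ∀ (c : ℝ) (n : ℕ), HasDerivAt (fun x : ℝ => (x - c) ^ n)
      ((n : ℝ) * (x - c) ^ (n - 1)) x := by
    intro c n
    have h := ((hasDerivAt_id x).sub_const c).pow n
    simp only [id, mul_one] at h
    exact h
  have d2 : HasDerivAt (fun x : ℝ => x ^ α) (α * (x ^ α / x)) x := by
    have := Real.hasDerivAt_rpow_const (x := x) (p := α) (Or.inl hx.ne')
    rwa [Real.rpow_sub_one hx.ne'] at this
  have d3 : HasDerivAt (fun x : ℝ => Real.exp (-x)) (-Real.exp (-x)) x := by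
    simpa using (hasDerivAt_neg x).exp
  have d4 := ((hasDerivAt_const x (4:ℝ)).div ((d1 r 2).mul (d1 s 2)) (by simp only [Pi.mul_apply]; positivity))
  have d5 := (hasDerivAt_id x).mul (((d1 r (k+1)).mul (d1 s (j+1))).mul ((d2.mul d3).mul d4))
  refine d5.congr_deriv ?_
  simp only [Pi.mul_apply, Pi.div_apply, id, Nat.add_sub_cancel]
  push_cast
  simp only [pow_succ]
  generalize x ^ α = A
  generalize Real.exp (-x) = E
  generalize hP : (x - r) ^ k = P
  generalize hQ : (x - s) ^ j = Q
  generalize x - r = p at *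
  generalize x - s = q at *
  norm_num
  field_simp
  ring

open Filter Topology Asymptotics in
theorem stmt_4 (α : ℝ) (hα : 0 < α)
    (r s : ℝ)
    (hr : r = -(α + 1) - Real.sqrt (α + 1))
    (hs : s = -(α + 1) + Real.sqrt (α + 1))
    (W : ℝ → ℝ)
    (hW : ∀ x : ℝ, W x = x ^ α * Real.exp (-x) /
      (x ^ 2 / 2 + (α + 1) * x + α * (α + 1) / 2) ^ 2)
    (μ : ℕ → ℕ → ℝ)
    (hμ : ∀ i j : ℕ, μ i j = ∫ x in Set.Ioi (0 : ℝ), (x - r) ^ i * (x - s) ^ j * W x) :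
    ∀ i j : ℕ, 1 ≤ i →
      μ (i + 1) (j + 1) =
        ((i : ℝ) + (j : ℝ) - 1 + 2 * α + Real.sqrt (α + 1)) * μ (i + 1) j +
        ((1 - (i : ℝ) - (j : ℝ)) * (α + 1) +
          (3 - 3 * (i : ℝ) - (j : ℝ) - 4 * α) * Real.sqrt (α + 1)) * μ i j +
        ((2 * (i : ℝ) - 4) * (α + 1) * (Real.sqrt (α + 1) + 1)) * μ (i - 1) j := by
  intro i j hi
  obtain ⟨k, rfl⟩ : ∃ k, i = k + 1 := ⟨i - 1, by omega⟩
  have ht2 : Real.sqrt (α + 1) ^ 2 = α + 1 := Real.sq_sqrt (by linarith)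
  have ht0 : 0 ≤ Real.sqrt (α + 1) := Real.sqrt_nonneg _
  generalize Real.sqrt (α + 1) = t at *
  have ht1 : 1 < t := by nlinarith
  have hr0 : r < 0 := by nlinarith
  have hs0 : s < 0 := by nlinarith
  have hα' : α = t ^ 2 - 1 := by linarith
  have hW' : W = fun x => x ^ α * Real.exp (-x) * (4 / ((x - r) ^ 2 * (x - s) ^ 2)) := by
    funext x
    have e : x ^ 2 / 2 + (α + 1) * x + α * (α + 1) / 2 = (x - r) * (x - s) / 2 := by
      rw [hr, hs, hα']; ring
    rw [hW, e, div_pow, mul_pow, div_eq_mul_inv, inv_div]; norm_num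
  have hint : ∀ i j : ℕ, IntegrableOn (fun x => (x - r) ^ i * (x - s) ^ j * W x) (Set.Ioi 0) := by
    intro i j
    rw [hW']
    exact integrable_of_isBigO_exp_neg (b := 1/4) (by norm_num) (aux_cont α r s hα hr0 hs0 i j)
      (aux_bigO α r s hα hr0 hs0 i j)
  have hlim : ∀ i j : ℕ, Tendsto (fun x => (x - r) ^ i * (x - s) ^ j * W x) atTop (𝓝 0) := by
    intro i j
    rw [hW']
    refine (aux_bigO α r s hα hr0 hs0 i j).trans_tendsto ?_
    refine Real.tendsto_exp_atBot.comp ?_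
    exact tendsto_id.const_mul_atTop_of_neg (by norm_num)
  set G : ℝ → ℝ := fun x =>
      -((x - r) ^ (k + 2) * (x - s) ^ (j + 1) * W x) +
      (((k : ℝ) + 1 + j - 1 + 2 * α + t) * ((x - r) ^ (k + 2) * (x - s) ^ j * W x) +
      (((1 - ((k : ℝ) + 1) - (j : ℝ)) * (α + 1) +
          (3 - 3 * ((k : ℝ) + 1) - (j : ℝ) - 4 * α) * t) * ((x - r) ^ (k + 1) * (x - s) ^ j * W x) +
      ((2 * ((k : ℝ) + 1) - 4) * (α + 1) * (t + 1)) * ((x - r) ^ k * (x - s) ^ j * W x))) with hG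
  have i1 := hint (k + 2) (j + 1)
  have i2 := (hint (k + 2) j).const_mul ((k : ℝ) + 1 + j - 1 + 2 * α + t)
  have i3 := (hint (k + 1) j).const_mul ((1 - ((k : ℝ) + 1) - (j : ℝ)) * (α + 1) +
          (3 - 3 * ((k : ℝ) + 1) - (j : ℝ) - 4 * α) * t)
  have i4 := (hint k j).const_mul ((2 * ((k : ℝ) + 1) - 4) * (α + 1) * (t + 1))
  have hGint : IntegrableOn G (Set.Ioi 0) := i1.neg.add (i2.add (i3.add i4))
  have hGval : ∫ x in Set.Ioi (0:ℝ), G x = -μ (k + 2) (j + 1) +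
      (((k : ℝ) + 1 + j - 1 + 2 * α + t) * μ (k + 2) j +
      (((1 - ((k : ℝ) + 1) - (j : ℝ)) * (α + 1) +
          (3 - 3 * ((k : ℝ) + 1) - (j : ℝ) - 4 * α) * t) * μ (k + 1) j +
      ((2 * ((k : ℝ) + 1) - 4) * (α + 1) * (t + 1)) * μ k j)) := by
    rw [hμ, hμ, hμ, hμ, ← integral_const_mul, ← integral_const_mul, ← integral_const_mul,
      ← integral_neg, ← integral_add i3 i4]
    have e1 := integral_add i2 (i3.add i4)
    have e2 := integral_add i1.neg (i2.add (i3.add i4))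
    simp only [Pi.add_apply, Pi.neg_apply] at e1 e2
    rw [← e1, ← e2]
  have hzero : ∫ x in Set.Ioi (0:ℝ), G x = 0 := by
    have key := integral_Ioi_of_hasDerivAt_of_tendsto (a := (0:ℝ)) (m := 0)
      (f := fun x : ℝ => x * ((x - r) ^ (k + 1) * (x - s) ^ (j + 1) * W x)) (f' := G)
      ?_ ?_ hGint ?_
    · rw [key]; simp
    · have c := aux_cont α r s hα hr0 hs0 (k + 1) (j + 1)
      rw [hW']
      exact (continuousOn_id.mul c) 0 Set.self_mem_Ici
    · intro x hx
      have d := aux_deriv α r s hr0 hs0 k j x hx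
      rw [hG, hW']
      refine d.congr_deriv ?_
      beta_reduce
      generalize x ^ α * Real.exp (-x) * (4 / ((x - r) ^ 2 * (x - s) ^ 2)) = w
      simp only [pow_succ (x - r), pow_succ (x - s)]
      generalize (x - r) ^ k = P
      generalize (x - s) ^ j = Q
      rw [hr, hs, hα']
      ring
    · have l := (hlim (k + 2) (j + 1)).add ((hlim (k + 1) (j + 1)).const_mul r)
      simp only [mul_zero, add_zero] at l
      refine l.congr ?_
      intro x
      ring
  rw [hGval] at hzero
  push_cast
  linarith
end

section
/- For every nonnegative integer i and every integer j ≥ 1, the adjusted moments satisfy the second four-term recursion μ̃_{i+1,j+1} = [i + j − 1 + 2α − √(α+1)] · μ̃_{i,j+1} + [(1 − i − j)(α+1) + (−3 + i + 3j + 4α)√(α+1)] · μ̃_{i,j} + [(−2j + 4)(α+1)(√(α+1) − 1)] · μ̃_{i,j−1}. -/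
open MeasureTheory

lemma aux_int1 (α : ℝ) (hα : 0 < α) (P : Polynomial ℝ) :
    IntegrableOn (fun x : ℝ => P.eval x * (x ^ α * Real.exp (-x))) (Set.Ioi 0) := by
  induction P using Polynomial.induction_on' with
  | add p q hp hq =>
    refine (hp.add hq).congr_fun (fun x _ => ?_) measurableSet_Ioi
    simp [add_mul]
  | monomial n a =>
    have h := (Real.GammaIntegral_convergent (s := α + n + 1) (by positivity)).const_mul a
    refine IntegrableOn.congr_fun h (fun x hx => ?_) measurableSet_Ioi
    have hx : (0 : ℝ) < x := hx
    have : x ^ (α + n + 1 - 1) = x ^ n * x ^ α := by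
      rw [add_sub_cancel_right, Real.rpow_add hx, Real.rpow_natCast, mul_comm]
    simp only [Polynomial.eval_monomial, this]
    ring

lemma aux_int2 (α : ℝ) (hα : 0 < α) (P : Polynomial ℝ) :
    IntegrableOn (fun x : ℝ => P.eval x * (x ^ α * Real.exp (-x) /
      (x ^ 2 / 2 + (α + 1) * x + α * (α + 1) / 2) ^ 2)) (Set.Ioi 0) := by
  have h := (aux_int1 α hα P)
  have hb : IntegrableOn (fun x : ℝ => (P.eval x * (x ^ α * Real.exp (-x))) *
      ((x ^ 2 / 2 + (α + 1) * x + α * (α + 1) / 2) ^ 2)⁻¹) (Set.Ioi 0) := by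
    refine Integrable.mul_bdd (c := ((α * (α + 1) / 2) ^ 2)⁻¹) h ?_ ?_
    · exact Measurable.aestronglyMeasurable (by fun_prop)
    · filter_upwards [ae_restrict_mem measurableSet_Ioi] with x hx
      have hx : (0 : ℝ) < x := hx
      rw [Real.norm_of_nonneg (by positivity)]
      gcongr
      have : 0 ≤ x ^ 2 / 2 + (α + 1) * x := by positivity
      linarith
  refine hb.congr_fun (fun x _ => ?_) measurableSet_Ioi
  simp only [div_eq_mul_inv]
  ring

theorem stmt_5 (α : ℝ) (hα : 0 < α)
    (r s : ℝ)
    (hr : r = -(α + 1) - Real.sqrt (α + 1))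
    (hs : s = -(α + 1) + Real.sqrt (α + 1))
    (W : ℝ → ℝ)
    (hW : ∀ x : ℝ, W x = x ^ α * Real.exp (-x) /
      (x ^ 2 / 2 + (α + 1) * x + α * (α + 1) / 2) ^ 2)
    (μ : ℕ → ℕ → ℝ)
    (hμ : ∀ i j : ℕ, μ i j = ∫ x in Set.Ioi (0 : ℝ), (x - r) ^ i * (x - s) ^ j * W x) :
    ∀ i j : ℕ, 1 ≤ j →
      μ (i + 1) (j + 1) =
        ((i : ℝ) + (j : ℝ) - 1 + 2 * α - Real.sqrt (α + 1)) * μ i (j + 1) +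
        ((1 - (i : ℝ) - (j : ℝ)) * (α + 1) +
          (-3 + (i : ℝ) + 3 * (j : ℝ) + 4 * α) * Real.sqrt (α + 1)) * μ i j +
        ((-2 * (j : ℝ) + 4) * (α + 1) * (Real.sqrt (α + 1) - 1)) * μ i (j - 1) := by
  intro i j hj
  obtain ⟨k, rfl⟩ : ∃ k, j = k + 1 := ⟨j - 1, by omega⟩
  have hR : Real.sqrt (α + 1) ^ 2 = α + 1 := Real.sq_sqrt (by linarith)
  simp only [Nat.add_sub_cancel]
  generalize Real.sqrt (α + 1) = R at *
  have hmom : ∀ i j : ℕ, IntegrableOn (fun x => (x - r) ^ i * (x - s) ^ j * W x) (Set.Ioi 0) := by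
    intro i j
    have h := aux_int2 α hα ((Polynomial.X - Polynomial.C r) ^ i * (Polynomial.X - Polynomial.C s) ^ j)
    refine h.congr_fun (fun x _ => ?_) measurableSet_Ioi
    simp [hW]
  have hFbl : IntegrableOn (fun x => (x - r) ^ (i + 1) * (x - s) ^ (k + 1) * (x * W x))
      (Set.Ioi 0) := by
    have h := aux_int2 α hα ((Polynomial.X - Polynomial.C r) ^ (i + 1) *
      (Polynomial.X - Polynomial.C s) ^ (k + 1) * Polynomial.X)
    refine h.congr_fun (fun x _ => ?_) measurableSet_Ioi
    simp [hW, mul_assoc]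
  set c1 : ℝ := ((i : ℝ) + ((k + 1 : ℕ) : ℝ) - 1 + 2 * α - R) with hc1
  set c2 : ℝ := ((1 - (i : ℝ) - ((k + 1 : ℕ) : ℝ)) * (α + 1) +
          (-3 + (i : ℝ) + 3 * ((k + 1 : ℕ) : ℝ) + 4 * α) * R) with hc2
  set c3 : ℝ := ((-2 * ((k + 1 : ℕ) : ℝ) + 4) * (α + 1) * (R - 1)) with hc3
  have hD : ∀ x : ℝ, x ^ 2 / 2 + (α + 1) * x + α * (α + 1) / 2 = (x - r) * (x - s) / 2 := by
    intro x
    rw [hr, hs]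
    linear_combination (-1 / 2 : ℝ) * -hR
  have hDpos : ∀ x : ℝ, 0 ≤ x → x ^ 2 / 2 + (α + 1) * x + α * (α + 1) / 2 ≠ 0 := by
    intro x hx
    positivity
  have hG : IntegrableOn (fun x => c1 * ((x - r) ^ i * (x - s) ^ (k + 1 + 1) * W x) +
      c2 * ((x - r) ^ i * (x - s) ^ (k + 1) * W x) + c3 * ((x - r) ^ i * (x - s) ^ k * W x) -
      (x - r) ^ (i + 1) * (x - s) ^ (k + 1 + 1) * W x) (Set.Ioi 0) :=
    ((((hmom _ _).const_mul _).add ((hmom _ _).const_mul _)).add ((hmom _ _).const_mul _)).sub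
      (hmom _ _)
  have hderiv : ∀ x ∈ Set.Ioi (0 : ℝ),
      HasDerivAt (fun x => (x - r) ^ (i + 1) * (x - s) ^ (k + 1) * (x * W x))
      (c1 * ((x - r) ^ i * (x - s) ^ (k + 1 + 1) * W x) +
      c2 * ((x - r) ^ i * (x - s) ^ (k + 1) * W x) + c3 * ((x - r) ^ i * (x - s) ^ k * W x) -
      (x - r) ^ (i + 1) * (x - s) ^ (k + 1 + 1) * W x) x := by
    intro x hx
    have hx : (0 : ℝ) < x := hx
    have hd0 := hDpos x hx.le
    have hpq : (x - r) * (x - s) ≠ 0 := by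
      intro h; apply hd0; rw [hD, h]; simp
    have hp : x - r ≠ 0 := left_ne_zero_of_mul hpq
    have hq : x - s ≠ 0 := right_ne_zero_of_mul hpq
    have hWe : W = fun x => x ^ α * Real.exp (-x) / ((x - r) * (x - s) / 2) ^ 2 := by
      funext y; rw [hW, hD]
    have h1 : HasDerivAt (fun x : ℝ => x ^ α) (α * x ^ (α - 1)) x :=
      Real.hasDerivAt_rpow_const (Or.inl hx.ne')
    have h2 : HasDerivAt (fun x : ℝ => Real.exp (-x)) (Real.exp (-x) * (-1)) x :=
      (hasDerivAt_neg x).exp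
    have hP : HasDerivAt (fun x : ℝ => x - r) 1 x := (hasDerivAt_id x).sub_const r
    have hQ : HasDerivAt (fun x : ℝ => x - s) 1 x := (hasDerivAt_id x).sub_const s
    have h3 := ((hP.mul hQ).div_const 2).pow 2
    have h4 := (h1.mul h2).div h3 (by simpa using ⟨hp, hq⟩)
    have h5 := ((hP.pow (i + 1)).mul (hQ.pow (k + 1))).mul ((hasDerivAt_id x).mul h4)
    rw [hWe]
    refine HasDerivAt.congr_deriv h5 ?_
    have hxa : x ^ (α - 1) = x ^ α / x := Real.rpow_sub_one hx.ne' α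
    simp only [Pi.mul_apply, Pi.pow_apply, Pi.div_apply, id, hxa, Nat.add_sub_cancel, hc1, hc2, hc3]
    generalize x ^ α = A
    generalize Real.exp (-x) = E
    have hα' : α = R ^ 2 - 1 := by linarith
    push_cast
    field_simp
    subst hr hs
    subst hα'
    ring
  have hlim := tendsto_zero_of_hasDerivAt_of_integrableOn_Ioi hderiv hG hFbl
  have hcont : ContinuousWithinAt (fun x => (x - r) ^ (i + 1) * (x - s) ^ (k + 1) * (x * W x))
      (Set.Ici 0) 0 := by
    have hWe : W = _ := funext hW
    rw [hWe]
    apply ContinuousAt.continuousWithinAt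
    have h1 : ContinuousAt (fun x : ℝ => x ^ α) 0 :=
      Real.continuousAt_rpow_const _ _ (Or.inr hα.le)
    have h2 : ContinuousAt (fun x : ℝ => x ^ α * Real.exp (-x) /
      (x ^ 2 / 2 + (α + 1) * x + α * (α + 1) / 2) ^ 2) 0 := by
      refine ContinuousAt.div (h1.mul (by fun_prop)) (by fun_prop) ?_
      exact pow_ne_zero 2 (hDpos 0 le_rfl)
    exact ContinuousAt.mul (by fun_prop) (continuousAt_id.mul h2)
  have key := integral_Ioi_of_hasDerivAt_of_tendsto hcont hderiv hG hlim
  rw [integral_sub, integral_add, integral_add, integral_const_mul, integral_const_mul,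
    integral_const_mul, ← hμ, ← hμ, ← hμ, ← hμ] at key
  · simp at key
    linarith
  · exact (hmom _ _).const_mul _
  · exact (hmom _ _).const_mul _
  · exact ((hmom _ _).const_mul _).add ((hmom _ _).const_mul _)
  · exact (hmom _ _).const_mul _
  · exact ((((hmom _ _).const_mul _).add ((hmom _ _).const_mul _)).add ((hmom _ _).const_mul _))
  · exact hmom _ _
end

section
/- The weight Ŵ solves the symmetry equation of the X₂ᴵ-Laguerre differential expression: for every x > 0, a₂(x) Ŵ′(x) + (a₂′(x) − a₁(x)) Ŵ(x) = 0, where a₂(x) = −x and a₁(x) = x − α − 1 + 4x(x + α + 1)/(x² + 2(α+1)x + α(α+1)). -/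
theorem stmt_7 (α : ℝ) (hα : 0 < α)
    (W : ℝ → ℝ)
    (hW : ∀ x : ℝ, W x = x ^ α * Real.exp (-x) /
      (x ^ 2 / 2 + (α + 1) * x + α * (α + 1) / 2) ^ 2)
    (a₁ a₂ : ℝ → ℝ)
    (ha₂ : ∀ x : ℝ, a₂ x = -x)
    (ha₁ : ∀ x : ℝ, a₁ x = x - α - 1 +
      4 * x * (x + α + 1) / (x ^ 2 + 2 * (α + 1) * x + α * (α + 1))) :
    ∀ x : ℝ, 0 < x →
      a₂ x * deriv W x + (deriv a₂ x - a₁ x) * W x = 0 := by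
  intro x hx
  have hP : 0 < x ^ 2 + 2 * (α + 1) * x + α * (α + 1) := by positivity
  have hQ : x ^ 2 / 2 + (α + 1) * x + α * (α + 1) / 2
      = (x ^ 2 + 2 * (α + 1) * x + α * (α + 1)) / 2 := by ring
  have hQ0 : x ^ 2 / 2 + (α + 1) * x + α * (α + 1) / 2 ≠ 0 := by
    rw [hQ]; positivity
  have hWf : W = fun x => x ^ α * Real.exp (-x) /
      (x ^ 2 / 2 + (α + 1) * x + α * (α + 1) / 2) ^ 2 := funext hW
  have ha2f : a₂ = fun x => -x := funext ha₂
  have hd2 : deriv a₂ x = -1 := by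
    rw [ha2f]; exact (hasDerivAt_neg x).deriv
  have h1 : HasDerivAt (fun x : ℝ => x ^ α) (α * x ^ (α - 1)) x :=
    Real.hasDerivAt_rpow_const (Or.inl hx.ne')
  have h2 : HasDerivAt (fun x : ℝ => Real.exp (-x)) (Real.exp (-x) * (-1)) x :=
    (hasDerivAt_neg x).exp
  have h3 : HasDerivAt (fun x : ℝ => x ^ 2 / 2 + (α + 1) * x + α * (α + 1) / 2)
      (x + α + 1) x := by
    have h := ((((hasDerivAt_id x).pow 2).div_const 2).add
      ((hasDerivAt_id x).const_mul (α + 1))).add_const (α * (α + 1) / 2)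
    refine h.congr_deriv ?_
    simp
    ring
  have hD := ((h1.mul h2).div (h3.pow 2) (pow_ne_zero 2 hQ0)).deriv
  have hWg : W = ((fun x : ℝ => x ^ α) * fun x => Real.exp (-x)) /
      (fun x => x ^ 2 / 2 + (α + 1) * x + α * (α + 1) / 2) ^ 2 := hWf
  rw [← hWg] at hD
  rw [hD, hd2, ha₂, ha₁, hW, Real.rpow_sub_one hx.ne']
  simp only [Pi.mul_apply, Pi.pow_apply, hQ]
  generalize hPP : x ^ 2 + 2 * (α + 1) * x + α * (α + 1) = P at *
  have := hP.ne'
  have := hx.ne'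
  field_simp
  ring
end

section
/- The initial adjusted moment μ̃_{1,2} satisfies μ̃_{1,2} = ∫₀^∞ (x − r)(x − s)² Ŵ(x) dx = 4 e^{−r} (−r)^α Γ(1 + α) · ∫_{−r}^∞ t^{−α−1} e^{−t} dt, i.e. μ̃_{1,2} = 4 e^{−r} (−r)^α Γ(1+α) Γ(−α, −r), where Γ(x, a) = ∫_a^∞ t^{x−1} e^{−t} dt denotes the upper incomplete Gamma function (a > 0). -/
open MeasureTheory

lemma aux_key (α b : ℝ) (hα : 0 < α) (hb : 0 < b) :
    Real.Gamma (1 + α) * ∫ t in Set.Ioi b, t ^ (-α - 1) * Real.exp (-t)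
      = ∫ x in Set.Ioi (0 : ℝ), x ^ α * (Real.exp (-(b * (x + 1))) / (x + 1)) := by
  have hG : 0 < Real.Gamma (1 + α) := Real.Gamma_pos_of_pos (by linarith)
  have h1 : ∀ t : ℝ, 0 < t → ∫ x in Set.Ioi (0 : ℝ), x ^ α * Real.exp (-(t * (x + 1)))
      = Real.Gamma (1 + α) * (t ^ (-α - 1) * Real.exp (-t)) := by
    intro t ht
    have h := Real.integral_rpow_mul_exp_neg_mul_Ioi (a := 1 + α) (r := t) (by linarith) ht
    have e : ∀ x : ℝ, x ^ α * Real.exp (-(t * (x + 1)))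
        = (x ^ (1 + α - 1) * Real.exp (-(t * x))) * Real.exp (-t) := by
      intro x
      rw [show -(t * (x + 1)) = -(t * x) + -t by ring, Real.exp_add,
        show 1 + α - 1 = α by ring]
      ring
    simp_rw [e]
    rw [integral_mul_const, h, one_div, Real.inv_rpow ht.le, ← Real.rpow_neg ht.le,
      show -(1 + α) = -α - 1 by ring]
    ring
  have h2 : ∀ x : ℝ, 0 < x → ∫ t in Set.Ioi b, x ^ α * Real.exp (-(t * (x + 1)))
      = x ^ α * (Real.exp (-(b * (x + 1))) / (x + 1)) := by
    intro x hx
    rw [integral_const_mul]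
    have h := integral_exp_mul_Ioi (a := -(x + 1)) (by linarith) b
    have e : ∀ t : ℝ, -(t * (x + 1)) = -(x + 1) * t := by intro t; ring
    simp_rw [e, h, neg_div_neg_eq]
  have hint : IntegrableOn (fun t : ℝ => t ^ (-α - 1) * Real.exp (-t)) (Set.Ioi b) := by
    have hE : IntegrableOn (fun t : ℝ => b ^ (-α - 1) * Real.exp (-t)) (Set.Ioi b) :=
      (integrableOn_exp_neg_Ioi b).const_mul _
    refine Integrable.mono' hE (by fun_prop) ?_
    filter_upwards [ae_restrict_mem measurableSet_Ioi] with t ht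
    have ht' : b < t := ht
    have h0 : 0 < t := hb.trans ht'
    rw [Real.norm_of_nonneg (by positivity)]
    exact mul_le_mul_of_nonneg_right
      (Real.rpow_le_rpow_of_nonpos hb ht'.le (by linarith)) (Real.exp_pos _).le
  have hprod : Integrable (Function.uncurry fun t x : ℝ => x ^ α * Real.exp (-(t * (x + 1))))
      ((volume.restrict (Set.Ioi b)).prod (volume.restrict (Set.Ioi 0))) := by
    rw [integrable_prod_iff (Measurable.aestronglyMeasurable (by
      unfold Function.uncurry; fun_prop))]
    constructor
    · filter_upwards [ae_restrict_mem measurableSet_Ioi] with t ht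
      have h0 : 0 < t := hb.trans ht
      refine Integrable.of_integral_ne_zero ?_
      simp only [Function.uncurry]
      rw [h1 t h0]
      positivity
    · refine (hint.const_mul (Real.Gamma (1 + α))).congr ?_
      filter_upwards [ae_restrict_mem measurableSet_Ioi] with t ht
      have h0 : 0 < t := hb.trans ht
      rw [← h1 t h0]
      refine setIntegral_congr_fun measurableSet_Ioi fun x hx => ?_
      have hx' : 0 < x := hx
      simp only [Function.uncurry]
      rw [Real.norm_of_nonneg (by positivity)]
  rw [← integral_const_mul]
  rw [setIntegral_congr_fun measurableSet_Ioi
    (fun t ht => (h1 t (hb.trans ht)).symm)]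
  rw [integral_integral_swap hprod]
  exact setIntegral_congr_fun measurableSet_Ioi (fun x hx => h2 x hx)

lemma aux_main (α b : ℝ) (hα : 0 < α) (hb : 0 < b) :
    ∫ x in Set.Ioi (0 : ℝ), x ^ α * Real.exp (-x) / (x + b)
      = Real.exp b * b ^ α * (Real.Gamma (1 + α) *
        ∫ t in Set.Ioi b, t ^ (-α - 1) * Real.exp (-t)) := by
  rw [aux_key α b hα hb, ← integral_const_mul]
  have h := integral_comp_mul_left_Ioi
    (fun x : ℝ => x ^ α * Real.exp (-x) / (x + b)) 0 hb
  rw [mul_zero, smul_eq_mul] at h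
  have h' : ∫ x in Set.Ioi (0 : ℝ), x ^ α * Real.exp (-x) / (x + b)
      = b * ∫ x in Set.Ioi (0 : ℝ), (b * x) ^ α * Real.exp (-(b * x)) / (b * x + b) := by
    rw [h]; field_simp
  rw [h', ← integral_const_mul]
  refine setIntegral_congr_fun measurableSet_Ioi fun x hx => ?_
  have hx' : 0 < x := hx
  beta_reduce
  rw [Real.mul_rpow hb.le hx'.le, show -(b * (x + 1)) = -(b * x) + -b by ring, Real.exp_add,
    Real.exp_neg b]
  have := Real.exp_pos b
  field_simp

theorem stmt_12 (α : ℝ) (hα : 0 < α)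
    (r s : ℝ)
    (hr : r = -(α + 1) - Real.sqrt (α + 1))
    (hs : s = -(α + 1) + Real.sqrt (α + 1))
    (W : ℝ → ℝ)
    (hW : ∀ x : ℝ, W x = x ^ α * Real.exp (-x) /
      (x ^ 2 / 2 + (α + 1) * x + α * (α + 1) / 2) ^ 2) :
    ∫ x in Set.Ioi (0 : ℝ), (x - r) * (x - s) ^ 2 * W x
      = 4 * Real.exp (-r) * (-r) ^ α * Real.Gamma (1 + α) *
          ∫ t in Set.Ioi (-r), t ^ (-α - 1) * Real.exp (-t) := by
  have hq := Real.sq_sqrt (show 0 ≤ α + 1 by linarith)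
  have hq0 := Real.sqrt_nonneg (α + 1)
  have hr0 : 0 < -r := by rw [hr]; linarith
  have hs0 : s < 0 := by rw [hs]; nlinarith
  have h := aux_main α (-r) hα hr0
  have e : ∫ x in Set.Ioi (0 : ℝ), (x - r) * (x - s) ^ 2 * W x
      = 4 * ∫ x in Set.Ioi (0 : ℝ), x ^ α * Real.exp (-x) / (x + -r) := by
    rw [← integral_const_mul]
    refine setIntegral_congr_fun measurableSet_Ioi fun x hx => ?_
    have hx' : 0 < x := hx
    have hp : x ^ 2 / 2 + (α + 1) * x + α * (α + 1) / 2 = (x - r) * (x - s) / 2 := by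
      rw [hr, hs]; linear_combination (1 / 2) * hq
    have h1 : x - r ≠ 0 := by apply ne_of_gt; linarith
    have h2 : x - s ≠ 0 := by apply ne_of_gt; linarith
    beta_reduce
    rw [hW, hp, ← sub_eq_add_neg]
    field_simp
    try ring
  rw [e, h]
  ring
end

section
/- For all real numbers a > 0 and β > −1, ∫₀^∞ e^{−x} x^β / (x + a) dx = e^{a} · a^{β} · Γ(1 + β) · ∫_{a}^∞ t^{−β−1} e^{−t} dt; equivalently, ∫₀^∞ e^{−x} x^β/(x + a) dx = e^{a} E_{1+β}(a) Γ(1+β), where E_ν(a) = ∫₁^∞ e^{−a t} t^{−ν} dt is the generalized exponential integral. -/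
open MeasureTheory

theorem aux_E (a β : ℝ) (ha : 0 < a) (hβ : -1 < β) :
    (∫ x in Set.Ioi (0 : ℝ), Real.exp (-x) * x ^ β / (x + a))
        = Real.exp a *
            (∫ t in Set.Ioi (1 : ℝ), Real.exp (-(a * t)) * t ^ (-(1 + β))) *
            Real.Gamma (1 + β) := by
  have hin : ∀ x ∈ Set.Ioi (0 : ℝ),
      (∫ t in Set.Ioi (1 : ℝ), Real.exp a * (x ^ β * Real.exp (-(x + a) * t)))
        = Real.exp (-x) * x ^ β / (x + a) := by
    intro x hx
    have hx' : (0 : ℝ) < x := hx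
    have hxa : x + a ≠ 0 := by positivity
    rw [integral_const_mul, integral_const_mul, integral_exp_mul_Ioi (by linarith)]
    have : Real.exp (-x) = Real.exp a * Real.exp (-(x + a) * 1) := by
      rw [← Real.exp_add]; congr 1; ring
    rw [this]
    field_simp
  have hout : ∀ t ∈ Set.Ioi (1 : ℝ),
      (∫ x in Set.Ioi (0 : ℝ), Real.exp a * (x ^ β * Real.exp (-(x + a) * t)))
        = Real.exp a * Real.Gamma (1 + β) * (Real.exp (-(a * t)) * t ^ (-(1 + β))) := by
    intro t ht
    have ht' : (0 : ℝ) < t := lt_trans one_pos ht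
    have h := Real.integral_rpow_mul_exp_neg_mul_Ioi (a := 1 + β) (r := t) (by linarith) ht'
    rw [integral_const_mul]
    have h2 : ∀ x : ℝ, x ^ β * Real.exp (-(x + a) * t)
        = Real.exp (-(a * t)) * (x ^ (1 + β - 1) * Real.exp (-(t * x))) := by
      intro x
      have : -(x + a) * t = -(a * t) + -(t * x) := by ring
      rw [this, Real.exp_add, add_sub_cancel_left]; ring
    simp_rw [h2]
    rw [integral_const_mul, h, one_div, Real.inv_rpow ht'.le, Real.rpow_neg ht'.le]
    ring
  have hG : IntegrableOn (fun x : ℝ => Real.exp (-x) * x ^ β / (x + a)) (Set.Ioi 0) := by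
    have h := (Real.GammaIntegral_convergent (s := 1 + β) (by linarith)).div_const a
    refine Integrable.mono h ?_ ?_
    · exact Measurable.aestronglyMeasurable (by fun_prop)
    · refine (ae_restrict_mem measurableSet_Ioi).mono fun x hx => ?_
      have hx' : (0 : ℝ) < x := hx
      rw [add_sub_cancel_left, Real.norm_of_nonneg (by positivity),
        Real.norm_of_nonneg (by positivity)]
      gcongr
      linarith
  have hI : Integrable (Function.uncurry fun x t : ℝ =>
      Real.exp a * (x ^ β * Real.exp (-(x + a) * t)))
      ((volume.restrict (Set.Ioi 0)).prod (volume.restrict (Set.Ioi 1))) := by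
    rw [integrable_prod_iff]
    · constructor
      · refine (ae_restrict_mem measurableSet_Ioi).mono fun x hx => ?_
        have hx' : (0 : ℝ) < x := hx
        exact ((integrableOn_exp_mul_Ioi (a := -(x + a)) (by linarith) 1).const_mul (x ^ β)).const_mul (Real.exp a)
      · refine Integrable.congr hG ?_
        refine (ae_restrict_mem measurableSet_Ioi).mono fun x hx => ?_
        have hx' : (0 : ℝ) < x := hx
        dsimp only [Function.uncurry]
        rw [← hin x hx]
        congr 1
        ext t
        rw [Real.norm_of_nonneg (by positivity)]
    · apply Measurable.aestronglyMeasurable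
      unfold Function.uncurry
      fun_prop
  have hs := integral_integral_swap hI
  rw [setIntegral_congr_fun measurableSet_Ioi hin, setIntegral_congr_fun measurableSet_Ioi hout,
    integral_const_mul] at hs
  rw [hs]; ring

theorem stmt_14 :
    ∀ a β : ℝ, 0 < a → -1 < β →
      (∫ x in Set.Ioi (0 : ℝ), Real.exp (-x) * x ^ β / (x + a))
        = Real.exp a * a ^ β * Real.Gamma (1 + β) *
            ∫ t in Set.Ioi a, t ^ (-β - 1) * Real.exp (-t) ∧
      (∫ x in Set.Ioi (0 : ℝ), Real.exp (-x) * x ^ β / (x + a))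
        = Real.exp a *
            (∫ t in Set.Ioi (1 : ℝ), Real.exp (-(a * t)) * t ^ (-(1 + β))) *
            Real.Gamma (1 + β) := by
  intro a β ha hβ
  refine ⟨?_, aux_E a β ha hβ⟩
  rw [aux_E a β ha hβ]
  have h := integral_comp_mul_left_Ioi' (fun t : ℝ => t ^ (-β - 1) * Real.exp (-t)) 1 ha
  rw [mul_one] at h
  rw [← h]
  have h2 : ∀ t ∈ Set.Ioi (1 : ℝ), (a * t) ^ (-β - 1) * Real.exp (-(a * t))
      = a ^ (-β - 1) * (Real.exp (-(a * t)) * t ^ (-(1 + β))) := by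
    intro t ht
    have ht' : (0 : ℝ) < t := lt_trans one_pos ht
    rw [Real.mul_rpow ha.le ht'.le, show -(1 + β) = -β - 1 by ring]
    ring
  rw [setIntegral_congr_fun measurableSet_Ioi h2, integral_const_mul, smul_eq_mul]
  have h3 : a ^ β * a * a ^ (-β - 1) = 1 := by
    rw [← Real.rpow_add_one ha.ne', ← Real.rpow_add ha]
    norm_num
  linear_combination (-(Real.exp a * Real.Gamma (1 + β) *
    ∫ t in Set.Ioi (1 : ℝ), Real.exp (-(a * t)) * t ^ (-(1 + β)))) * h3
end

section
/- The degree-two flag element v₂(x) = (1/2)(x − r)(x − s) + (x − r) − √(α+1) satisfies both X₂ᴵ-Laguerre exceptional conditions: r · v₂′(r) + α · v₂(r) = 0 and s · v₂′(s) + α · v₂(s) = 0. -/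
theorem stmt_17 (α : ℝ) (hα : 0 < α)
    (r s : ℝ)
    (hr : r = -(α + 1) - Real.sqrt (α + 1))
    (hs : s = -(α + 1) + Real.sqrt (α + 1))
    (v₂ : ℝ → ℝ)
    (hv₂ : ∀ x : ℝ, v₂ x = (1 / 2) * (x - r) * (x - s) + (x - r) - Real.sqrt (α + 1)) :
    r * deriv v₂ r + α * v₂ r = 0 ∧ s * deriv v₂ s + α * v₂ s = 0 := by
  have hq : Real.sqrt (α + 1) ^ 2 = α + 1 := Real.sq_sqrt (by linarith)
  have hd : ∀ x : ℝ, deriv v₂ x = (1 / 2) * ((x - s) + (x - r)) + 1 := by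
    intro x
    have h1 : HasDerivAt (fun y : ℝ => y - r) 1 x := (hasDerivAt_id' x).sub_const r
    have h2 : HasDerivAt (fun y : ℝ => y - s) 1 x := (hasDerivAt_id' x).sub_const s
    have h3 := (((h1.const_mul (1 / 2 : ℝ)).mul h2).add h1).sub_const (Real.sqrt (α + 1))
    have h4 : HasDerivAt v₂ _ x := h3.congr_of_eventuallyEq (Filter.Eventually.of_forall hv₂)
    rw [h4.deriv]
    ring
  rw [hd, hd, hv₂, hv₂]
  generalize Real.sqrt (α + 1) = q at *
  have ha : α = q ^ 2 - 1 := by linarith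
  subst hr hs ha
  constructor <;> ring
end

section
/- The degree-three flag element v₃(x) = (x − r)²(x − s + 1) satisfies both X₂ᴵ-Laguerre exceptional conditions: r · v₃′(r) + α · v₃(r) = 0 and s · v₃′(s) + α · v₃(s) = 0. -/
theorem stmt_18 (α : ℝ) (hα : 0 < α)
    (r s : ℝ)
    (hr : r = -(α + 1) - Real.sqrt (α + 1))
    (hs : s = -(α + 1) + Real.sqrt (α + 1))
    (v₃ : ℝ → ℝ)
    (hv₃ : ∀ x : ℝ, v₃ x = (x - r) ^ 2 * (x - s + 1)) :
    r * deriv v₃ r + α * v₃ r = 0 ∧ s * deriv v₃ s + α * v₃ s = 0 := by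
  have hd : ∀ x : ℝ, deriv v₃ x = 2 * (x - r) * (x - s + 1) + (x - r) ^ 2 := by
    intro x
    have h1 : v₃ = fun x => (x - r) ^ 2 * (x - s + 1) := funext hv₃
    rw [h1]
    have h2 := (((hasDerivAt_id x).sub_const r).pow 2).mul
      (((hasDerivAt_id x).sub_const s).add_const 1)
    have h3 : HasDerivAt (fun x : ℝ => (x - r) ^ 2 * (x - s + 1))
        (2 * (x - r) * (x - s + 1) + (x - r) ^ 2) x := by
      refine h2.congr_deriv ?_
      simp [id]
    exact h3.deriv
  have hq : Real.sqrt (α + 1) ^ 2 = α + 1 := Real.sq_sqrt (by linarith)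
  rw [hd, hd, hv₃, hv₃]
  generalize Real.sqrt (α + 1) = q at *
  have ha : α = q ^ 2 - 1 := by linarith
  subst ha
  subst hr hs
  constructor <;> ring
end
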